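/- Let 0<ℓ≤∞, let p ∈ P₁([0,ℓ]) and β, ν ∈ P([0,ℓ]) with 0 ≤ ν(0) < 1/p(0) (and, if ℓ=∞, also 0 ≤ ν(∞) < 1/p(∞)), and let q ∈ P₁([0,ℓ]) satisfy 1/q(0) = 1/p(0) − ν(0) (and, if ℓ=∞, 1/q(∞) = 1/p(∞) − ν(∞)). Then there exists a constant C > 0 such that the Hardy-type inequality ‖ t^{β(t)+ν(t)} ∫ₜ^ℓ f(s) s^{−β(s)−1} ds ‖_{L^{q(·)}([0,ℓ])} ≤ C ‖f‖_{L^{p(·)}([0,ℓ])} holds for all nonnegative f ∈ L^{p(·)}([0,ℓ]) if and only if β(0) > −1/p(0) (and, if ℓ=∞, β(∞) > −1/p(∞)). -/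

import Mathlib

open MeasureTheory Filter Set Metric
open scoped ENNReal NNReal Topology

noncomputable section

/-- The non-increasing rearrangement `f*` of `f` with respect to the measure `μ`:
`f*(t) = sup { s ≥ 0 : μ{|f| > s} > t }`. -/
def rearrange {α : Type*} [MeasurableSpace α] (μ : Measure α) (f : α → ℝ) (t : ℝ) : ℝ :=
  sSup {s : ℝ | 0 ≤ s ∧ ENNReal.ofReal t < μ {x | s < |f x|}}

/-- The maximal function of the rearrangement: `f**(t) = (1/t) ∫₀ᵗ f*(s) ds`. -/
def doubleStar {α : Type*} [MeasurableSpace α] (μ : Measure α) (f : α → ℝ) (t : ℝ) : ℝ :=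
  (1 / t) * ∫ s in Ioo (0 : ℝ) t, rearrange μ f s

/-- The Luxemburg norm of `g` in the variable exponent Lebesgue space `L^{q(·)}([0,ℓ])`. -/
def luxNorm (ℓ : ℝ≥0∞) (q : ℝ → ℝ) (g : ℝ → ℝ) : ℝ≥0∞ :=
  sInf {lam : ℝ≥0∞ | 0 < lam ∧
    (∫⁻ t in {t : ℝ | 0 < t ∧ ENNReal.ofReal t < ℓ},
      (ENNReal.ofReal |g t| / lam) ^ q t) ≤ 1}

/-- The class `P([0,ℓ])`: bounded measurable exponents with limits `p0` at `0` and
(if `ℓ = ∞`) `pinf` at `∞`, satisfying log-decay conditions at `0` and at `∞`. -/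
structure ClassP (ℓ : ℝ≥0∞) (p : ℝ → ℝ) (p0 pinf : ℝ) : Prop where
  measurable : Measurable p
  bounded : ∃ M : ℝ, ∀ t : ℝ, 0 ≤ t → ENNReal.ofReal t ≤ ℓ → |p t| ≤ M
  lim_zero : Tendsto p (nhdsWithin 0 (Ioi 0)) (nhds p0)
  decay_zero : ∃ C > 0, ∀ t : ℝ, 0 < t → t ≤ 1 / 2 → |p t - p0| ≤ C / Real.log (1 / t)
  lim_infty : ℓ = ∞ → Tendsto p atTop (nhds pinf)
  decay_infty : ℓ = ∞ → ∃ C > 0, ∀ t : ℝ, 0 ≤ t → |p t - pinf| ≤ C / Real.log (Real.exp 1 + t)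

/-- The class `P_a([0,ℓ]) = P([0,ℓ]) ∩ {p : a < p₋ ≤ p₊ < ∞}`. -/
def ClassPa (a : ℝ) (ℓ : ℝ≥0∞) (p : ℝ → ℝ) (p0 pinf : ℝ) : Prop :=
  ClassP ℓ p p0 pinf ∧
    ∃ pm pM : ℝ, a < pm ∧ ∀ t : ℝ, 0 ≤ t → ENNReal.ofReal t ≤ ℓ → pm ≤ p t ∧ p t ≤ pM

/-- The variable exponent Lorentz norm `‖f‖_{L^{p(·),q(·)}(Ω)}`. -/
def lorentzNorm {α : Type*} [MeasurableSpace α] (μ : Measure α) (p q : ℝ → ℝ)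
    (f : α → ℝ) : ℝ≥0∞ :=
  luxNorm (μ univ) q fun t => t ^ (1 / p t - 1 / q t) * rearrange μ f t

/-- The variable exponent Lorentz norm `‖f‖¹_{L^{p(·),q(·)}(Ω)}` defined via `f**`. -/
def lorentzNorm1 {α : Type*} [MeasurableSpace α] (μ : Measure α) (p q : ℝ → ℝ)
    (f : α → ℝ) : ℝ≥0∞ :=
  luxNorm (μ univ) q fun t => t ^ (1 / p t - 1 / q t) * doubleStar μ f t

/-- The weighted variable exponent Lorentz norm `‖f‖_{L^{p(·),q(·)}_w(Ω)}`. -/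
def wLorentzNorm {α : Type*} [MeasurableSpace α] (μ : Measure α) (w p q : ℝ → ℝ)
    (f : α → ℝ) : ℝ≥0∞ :=
  luxNorm (μ univ) q fun t => w t * t ^ (1 / p t - 1 / q t) * rearrange μ f t

/-- The weighted variable exponent Lorentz norm `‖f‖¹_{L^{p(·),q(·)}_w(Ω)}` via `f**`. -/
def wLorentzNorm1 {α : Type*} [MeasurableSpace α] (μ : Measure α) (w p q : ℝ → ℝ)
    (f : α → ℝ) : ℝ≥0∞ :=
  luxNorm (μ univ) q fun t => w t * t ^ (1 / p t - 1 / q t) * doubleStar μ f t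

/-- An ergodic flow `(T_τ)_{τ∈ℝ}` of measure preserving transformations on `(X,μ)`. -/
structure ErgodicFlow (X : Type*) [MeasurableSpace X] (μ : Measure X)
    (T : ℝ → X → X) : Prop where
  measurable : Measurable fun p : ℝ × X => T p.1 p.2
  preserving : ∀ τ : ℝ, MeasurePreserving (T τ) μ μ
  map_zero : ∀ x, T 0 x = x
  map_add : ∀ s t x, T (s + t) x = T s (T t x)
  ergodic : ∀ A : Set X, MeasurableSet A → (∀ τ, T τ ⁻¹' A = A) → μ A = 0 ∨ μ Aᶜ = 0

/-- The ergodic maximal function `Mf(x) = sup_{a>0} (1/a)∫₀^a |f(T_τ x)| dτ`. -/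
def ergMax {X : Type*} (T : ℝ → X → X) (f : X → ℝ) (x : X) : ℝ :=
  ⨆ a : {a : ℝ // 0 < a}, (1 / (a : ℝ)) * ∫ τ in Ioo (0 : ℝ) (a : ℝ), |f (T τ x)|

/-- The ergodic Hilbert transform
`Hf(x) = lim_{δ→0+} ∫_{δ ≤ |τ| ≤ 1/δ} f(T_τ x)/τ dτ`. -/
def ergHilbert {X : Type*} (T : ℝ → X → X) (f : X → ℝ) (x : X) : ℝ :=
  limUnder (nhdsWithin (0 : ℝ) (Ioi 0)) fun δ =>
    ∫ τ in {τ : ℝ | δ ≤ |τ| ∧ |τ| ≤ 1 / δ}, f (T τ x) / τ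


/-- Piecewise constant exponent. -/
def stp (x0 xi t : ℝ) : ℝ := if t ≤ 1 then x0 else xi

/-- The domain. -/
def dom (ℓ : ℝ≥0∞) : Set ℝ := {t : ℝ | 0 < t ∧ ENNReal.ofReal t < ℓ}

theorem measurableSet_dom (ℓ : ℝ≥0∞) : MeasurableSet (dom ℓ) := by
  apply MeasurableSet.inter
  · exact measurableSet_lt measurable_const measurable_id
  · exact measurableSet_lt ENNReal.measurable_ofReal measurable_const

theorem decay_aux {ℓ : ℝ≥0∞} {x : ℝ → ℝ} {x0 xinf : ℝ} (h : ClassP ℓ x x0 xinf) :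
    ∃ A : ℝ, 0 ≤ A ∧ ∀ t ∈ dom ℓ,
      |x t - stp x0 (if ℓ = ∞ then xinf else x0) t| * |Real.log t| ≤ A := by
  obtain ⟨M, hM⟩ := h.bounded
  obtain ⟨C, hC, hC'⟩ := h.decay_zero
  have hM' : ∀ t ∈ dom ℓ, |x t - x0| ≤ |M| + |x0| := by
    intro t ht
    have := hM t ht.1.le ht.2.le
    have h2 := abs_sub (x t) x0
    have h3 := le_abs_self M
    linarith
  have hz : ∀ t ∈ dom ℓ, t ≤ 1 → |x t - x0| * |Real.log t| ≤ C + (|M| + |x0|) := by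
    intro t ht ht1
    have ht0 := ht.1
    have hl : Real.log t ≤ 0 := Real.log_nonpos ht0.le ht1
    rw [abs_of_nonpos hl]
    by_cases h2 : t ≤ 1 / 2
    · have h3 := hC' t ht0 h2
      have h4 : Real.log (1 / t) = - Real.log t := by rw [one_div, Real.log_inv]
      have h5 : 0 < - Real.log t := by
        have := Real.log_neg ht0 (by linarith); linarith
      rw [h4, le_div_iff₀ h5] at h3
      have := abs_nonneg M
      have := abs_nonneg x0
      linarith
    · push Not at h2
      have h6 : Real.log (1/2) ≤ Real.log t := Real.log_le_log (by norm_num) h2.le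
      have h7 : Real.log (1/2) = - Real.log 2 := by rw [one_div, Real.log_inv]
      have h8 := Real.log_two_lt_d9
      have h9 := hM' t ht
      have h10 : -Real.log t ≤ 1 := by linarith
      have := mul_le_mul h9 h10 (by linarith) (by positivity)
      linarith
  by_cases hl : ℓ = ∞
  · obtain ⟨C2, hC2, hC2'⟩ := h.decay_infty hl
    refine ⟨C + (|M| + |x0|) + C2, by positivity, ?_⟩
    intro t ht
    unfold stp
    split_ifs with h1
    · have := hz t ht h1
      linarith
    · push Not at h1
      have h3 := hC2' t ht.1.le
      have he := Real.exp_pos 1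
      have h4 : Real.log t ≤ Real.log (Real.exp 1 + t) := Real.log_le_log ht.1 (by linarith)
      have h5 : 0 < Real.log t := Real.log_pos h1
      rw [le_div_iff₀ (by linarith)] at h3
      rw [abs_of_pos h5]
      have := mul_le_mul_of_nonneg_left h4 (abs_nonneg (x t - xinf))
      have := abs_nonneg M
      have := abs_nonneg x0
      linarith
  · simp only [hl, if_false]
    refine ⟨C + (|M| + |x0|) + (|M| + |x0|) * |Real.log ℓ.toReal|, by positivity, ?_⟩
    intro t ht
    have hs : stp x0 x0 t = x0 := by unfold stp; simp
    rw [hs]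
    by_cases h1 : t ≤ 1
    · have := hz t ht h1
      have : 0 ≤ (|M| + |x0|) * |Real.log ℓ.toReal| := by positivity
      linarith
    · push Not at h1
      have h5 : 0 < Real.log t := Real.log_pos h1
      have h6 : t ≤ ℓ.toReal := by
        have := ht.2.le
        exact (ENNReal.ofReal_le_iff_le_toReal hl).1 this
      have h7 := Real.log_le_log ht.1 h6
      rw [abs_of_pos h5]
      have h8 : Real.log t ≤ |Real.log ℓ.toReal| := h7.trans (le_abs_self _)
      have := mul_le_mul (hM' t ht) h8 h5.le (by positivity)
      have := abs_nonneg M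
      have := abs_nonneg x0
      linarith

theorem inv_close {p P : ℝ} (hp : 1 ≤ p) (hP : 1 ≤ P) : |1 / p - 1 / P| ≤ |p - P| := by
  have : 1 / p - 1 / P = (P - p) / (p * P) := by field_simp
  rw [this, abs_div, abs_sub_comm, abs_of_pos (by positivity : 0 < p * P)]
  exact div_le_self (abs_nonneg _) (by nlinarith)

theorem close_mul {x X L A : ℝ} (h : |x - X| * |L| ≤ A) :
    L * x ≤ L * X + A ∧ L * X ≤ L * x + A := by
  rw [← abs_mul] at h
  have := abs_le.1 h
  constructor <;> nlinarith [this.1, this.2]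

/-- kernel exponent estimate -/
theorem kernel_exp {L S A a bt vt qt bs ps Bt Vt Pt Qt Bs Ps : ℝ}
    (hbt : |bt - Bt| * |L| ≤ A) (hvt : |vt - Vt| * |L| ≤ A) (hqt : |qt - Qt| * |L| ≤ A)
    (hbs : |bs - Bs| * |S| ≤ A) (hps : |ps - Ps| * |S| ≤ A)
    (hq1 : 1 ≤ qt) (hQ1 : 1 ≤ Qt) (hp1 : 1 ≤ ps) (hP1 : 1 ≤ Ps)
    (hQ : 1 / Qt = 1 / Pt - Vt)
    (hcmp : L * (Bt + 1 / Pt) - S * (Bs + 1 / Ps) ≤ a * (L - S)) :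
    L * (bt + vt + 1 / qt) - S * (bs + 1 / ps) ≤ 5 * A + a * (L - S) := by
  have h1 := (close_mul hbt).1
  have h2 := (close_mul hvt).1
  have h3 := (close_mul ((mul_le_mul_of_nonneg_right (inv_close hq1 hQ1) (abs_nonneg L)).trans hqt)).1
  have h4 := (close_mul hbs).2
  have h5 := (close_mul ((mul_le_mul_of_nonneg_right (inv_close hp1 hP1) (abs_nonneg S)).trans hps)).2
  rw [hQ] at h3
  nlinarith

theorem cmp_stp {t s a b0 bi P0 Pi : ℝ} (ht : 0 < t) (hts : t < s)
    (h0 : a ≤ b0 + 1 / P0) (hi : a ≤ bi + 1 / Pi) :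
    Real.log t * (stp b0 bi t + 1 / stp P0 Pi t) - Real.log s * (stp b0 bi s + 1 / stp P0 Pi s)
      ≤ a * (Real.log t - Real.log s) := by
  have hl := Real.log_lt_log ht hts
  unfold stp
  by_cases h1 : t ≤ 1 <;> by_cases h2 : s ≤ 1
  · simp only [h1, h2, if_true]; nlinarith
  · simp only [h1, h2, if_true, if_false]
    have := Real.log_nonpos ht.le h1
    have := Real.log_pos (not_le.1 h2)
    nlinarith
  · linarith
  · simp only [h1, h2, if_false]; nlinarith

theorem cross_stp {t s A M p P0 Pi : ℝ} (ht : 0 < t) (hts : t < s)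
    (hA : |p - stp P0 Pi s| * |Real.log s| ≤ A)
    (hA0 : 0 ≤ A) (hp : 0 ≤ p) (hpM : p ≤ M) (h0 : 0 ≤ P0) (h0M : P0 ≤ M)
    (hi : 0 ≤ Pi) (hiM : Pi ≤ M) :
    |stp P0 Pi t - p| * |Real.log t| ≤ A + M * (Real.log s - Real.log t) := by
  have hl := Real.log_lt_log ht hts
  rw [abs_sub_comm]
  unfold stp at *
  by_cases h1 : t ≤ 1 <;> by_cases h2 : s ≤ 1
  · simp only [h1, h2, if_true] at hA ⊢
    have e1 := Real.log_nonpos ht.le h1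
    have e2 := Real.log_nonpos (ht.trans hts).le h2
    rw [abs_of_nonpos e1]
    rw [abs_of_nonpos e2] at hA
    have : |p - P0| ≤ M := abs_le.2 ⟨by linarith, by linarith⟩
    nlinarith
  · simp only [h1, if_true] at hA ⊢
    have e1 := Real.log_nonpos ht.le h1
    have e2 := Real.log_pos (not_le.1 h2)
    rw [abs_of_nonpos e1]
    have : |p - P0| ≤ M := abs_le.2 ⟨by linarith, by linarith⟩
    have : |p - P0| * (-Real.log t) ≤ M * (-Real.log t) :=
      mul_le_mul_of_nonneg_right this (by linarith)
    nlinarith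
  · linarith
  · simp only [h1, h2, if_false] at hA ⊢
    have e1 := Real.log_pos (not_le.1 h1)
    rw [abs_of_pos e1]
    rw [abs_of_pos (e1.trans hl)] at hA
    have := mul_le_mul_of_nonneg_left hl.le (abs_nonneg (p - Pi))
    nlinarith

/-- powers of rho -/
theorem rho_pow {rho mL y E : ℝ} (h0 : Real.exp (-mL) ≤ rho) (h1 : rho ≤ 1) (hE : 0 ≤ E)
    (hy : mL * (-y) ≤ E) : rho ^ y ≤ Real.exp E := by
  have hr : 0 < rho := (Real.exp_pos _).trans_le h0
  rw [Real.rpow_def_of_pos hr, Real.exp_le_exp]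
  have l0 : -mL ≤ Real.log rho := by
    have := Real.log_le_log (Real.exp_pos _) h0
    rwa [Real.log_exp] at this
  have l1 : Real.log rho ≤ 0 := Real.log_nonpos hr.le h1
  by_cases hy0 : 0 ≤ y
  · nlinarith
  · push Not at hy0
    nlinarith

theorem pointwise {t s a m A M bt vt qt bs ps r rho f : ℝ}
    (ht : 0 < t) (hs : 0 < s) (hf : 0 ≤ f)
    (hk : Real.log t * (bt + vt + 1 / qt) - Real.log s * (bs + 1 / ps)
      ≤ 5 * A + a * (Real.log t - Real.log s))
    (hcr : |r - ps| * |Real.log t| ≤ A + M * (Real.log s - Real.log t))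
    (hts : t < s) (hm : 0 < m) (hmM : m * M ≤ a / 2) (hA : 0 ≤ A) (ha : 0 < a)
    (hr : 1 ≤ r) (hp : 1 ≤ ps)
    (h0 : Real.exp (-(m * |Real.log t|)) ≤ rho) (h1 : rho ≤ 1) :
    t ^ (bt + vt) * (f / s ^ (bs + 1)) ≤
      (Real.exp (5 * A + m * A) * t ^ (-(1 / qt)) * rho ^ (1 / r)) *
        ((t / s) ^ a * s⁻¹ + rho⁻¹ * ((t / s) ^ (a / 2) * f ^ ps)) := by
  have hrho : 0 < rho := (Real.exp_pos _).trans_le h0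
  have hl := Real.log_lt_log ht hts
  have hp0 : ps ≠ 0 := by linarith
  set c := rho ^ (1 / r) with hc
  have hcpos : 0 < c := Real.rpow_pos_of_pos hrho _
  set g := s ^ (1 / ps) * f with hg
  have hg0 : 0 ≤ g := by positivity
  have hgp : g ^ ps = s * f ^ ps := by
    rw [hg, Real.mul_rpow (by positivity) hf, ← Real.rpow_mul hs.le, one_div_mul_cancel hp0,
      Real.rpow_one]
  have hK : t ^ (bt + vt + 1 / qt) * s ^ (-(bs + 1 / ps)) ≤ Real.exp (5 * A) * (t / s) ^ a := by
    rw [Real.rpow_def_of_pos ht, Real.rpow_def_of_pos hs, Real.rpow_def_of_pos (by positivity),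
      Real.log_div ht.ne' hs.ne', ← Real.exp_add, ← Real.exp_add, Real.exp_le_exp]
    linarith
  have hLHS : t ^ (bt + vt) * (f / s ^ (bs + 1)) =
      t ^ (-(1 / qt)) * (t ^ (bt + vt + 1 / qt) * s ^ (-(bs + 1 / ps))) * g * s⁻¹ := by
    have e1 : t ^ (bt + vt) = t ^ (-(1 / qt)) * t ^ (bt + vt + 1 / qt) := by
      rw [← Real.rpow_add ht]; congr 1; ring
    have e2 : (s ^ (bs + 1))⁻¹ = s ^ (-(bs + 1 / ps)) * s ^ (1 / ps) * s⁻¹ := by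
      rw [← Real.rpow_neg hs.le, ← Real.rpow_neg_one s, ← Real.rpow_add hs, ← Real.rpow_add hs]
      congr 1; ring
    rw [div_eq_mul_inv, e1, e2, hg]; ring
  have hgle : g ≤ c + c ^ (1 - ps) * g ^ ps := by
    by_cases hgc : g ≤ c
    · have : 0 ≤ c ^ (1 - ps) * g ^ ps := by positivity
      linarith
    · push Not at hgc
      have hgpos := hcpos.trans hgc
      have : g ^ (1 - ps) ≤ c ^ (1 - ps) :=
        Real.rpow_le_rpow_of_nonpos hcpos hgc.le (by linarith)
      have e : g = g ^ (1 - ps) * g ^ ps := by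
        rw [← Real.rpow_add hgpos]; simp
      have h2 := mul_le_mul_of_nonneg_right this (by positivity : 0 ≤ g ^ ps)
      linarith
  have hcp : c ^ (1 - ps) ≤ c * rho⁻¹ * (Real.exp (m * A) * (t / s) ^ (-(a / 2))) := by
    have e : c ^ (1 - ps) = c * rho⁻¹ * rho ^ ((r - ps) / r) := by
      rw [hc, ← Real.rpow_mul hrho.le, ← Real.rpow_neg_one rho, ← Real.rpow_add hrho,
        ← Real.rpow_add hrho]
      congr 1; field_simp; ring
    rw [e]
    refine mul_le_mul_of_nonneg_left ?_ (by positivity)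
    have e2 : Real.exp (m * A) * (t / s) ^ (-(a / 2)) =
        Real.exp (m * A + (a / 2) * (Real.log s - Real.log t)) := by
      rw [Real.rpow_def_of_pos (by positivity), Real.log_div ht.ne' hs.ne', ← Real.exp_add]
      congr 1; ring
    rw [e2]
    refine rho_pow h0 h1 (by nlinarith [mul_nonneg hm.le hA]) ?_
    have h3 : -((r - ps) / r) ≤ |r - ps| := by
      rw [← neg_div]
      calc -(r - ps) / r ≤ |r - ps| / r := by
            gcongr; exact neg_le_abs _
        _ ≤ |r - ps| := div_le_self (abs_nonneg _) hr
    calc m * |Real.log t| * -((r - ps) / r) ≤ m * |Real.log t| * |r - ps| :=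
          mul_le_mul_of_nonneg_left h3 (by positivity)
      _ = m * (|r - ps| * |Real.log t|) := by ring
      _ ≤ m * (A + M * (Real.log s - Real.log t)) := mul_le_mul_of_nonneg_left hcr hm.le
      _ ≤ _ := by nlinarith
  rw [hLHS]
  have hexp : Real.exp (5 * A) ≤ Real.exp (5 * A + m * A) :=
    Real.exp_le_exp.2 (by nlinarith [mul_nonneg hm.le hA])
  calc t ^ (-(1 / qt)) * (t ^ (bt + vt + 1 / qt) * s ^ (-(bs + 1 / ps))) * g * s⁻¹
      ≤ t ^ (-(1 / qt)) * (Real.exp (5 * A) * (t / s) ^ a) *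
        (c + (c * rho⁻¹ * (Real.exp (m * A) * (t / s) ^ (-(a / 2)))) * (s * f ^ ps)) * s⁻¹ := by
        have : g ≤ c + (c * rho⁻¹ * (Real.exp (m * A) * (t / s) ^ (-(a / 2)))) * (s * f ^ ps) := by
          rw [← hgp]
          have := mul_le_mul_of_nonneg_right hcp (by positivity : 0 ≤ g ^ ps)
          linarith
        gcongr
    _ = t ^ (-(1 / qt)) * c * (Real.exp (5 * A) * ((t / s) ^ a * s⁻¹) +
        Real.exp (5 * A + m * A) * (rho⁻¹ * ((t / s) ^ (a / 2) * f ^ ps))) := by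
        have e1 : (t / s) ^ (a / 2) = (t / s) ^ a * (t / s) ^ (-(a / 2)) := by
          rw [← Real.rpow_add (by positivity)]; congr 1; ring
        rw [e1, Real.exp_add]
        field_simp
    _ ≤ t ^ (-(1 / qt)) * c * (Real.exp (5 * A + m * A) * ((t / s) ^ a * s⁻¹) +
        Real.exp (5 * A + m * A) * (rho⁻¹ * ((t / s) ^ (a / 2) * f ^ ps))) := by
        gcongr
    _ = _ := by ring

theorem final_pow {t q r Q m A M K rho : ℝ} (ht : 0 < t) (hq : 1 ≤ q) (hqM : q ≤ M) (hr : 1 ≤ r)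
    (hrQ : r ≤ Q) (hA : |q - Q| * |Real.log t| ≤ A) (hA0 : 0 ≤ A) (hm : 0 < m) (hK : 1 ≤ K)
    (h0 : Real.exp (-(m * |Real.log t|)) ≤ rho) (h1 : rho ≤ 1) :
    (K * t ^ (-(1 / q)) * rho ^ (1 / r)) ^ q ≤ K ^ M * Real.exp (m * A) * (t⁻¹ * rho) := by
  have hrho : 0 < rho := (Real.exp_pos _).trans_le h0
  have hq0 : q ≠ 0 := by linarith
  rw [Real.mul_rpow (by positivity) (by positivity), Real.mul_rpow (by positivity) (by positivity),
    ← Real.rpow_mul ht.le, ← Real.rpow_mul hrho.le]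
  have e1 : -(1 / q) * q = -1 := by field_simp
  rw [e1, Real.rpow_neg_one]
  have e2 : rho ^ (1 / r * q) = rho * rho ^ ((q - r) / r) := by
    rw [← Real.rpow_one_add' hrho.le]
    · congr 1; field_simp; ring
    · have : 1 + (q - r) / r = q / r := by field_simp; ring
      rw [this]; positivity
  rw [e2]
  have h3 : rho ^ ((q - r) / r) ≤ Real.exp (m * A) := by
    refine rho_pow h0 h1 (by positivity) ?_
    have : -((q - r) / r) ≤ |q - Q| := by
      rw [← neg_div]
      calc -(q - r) / r ≤ |q - Q| / r := by
            gcongr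
            have := neg_le_abs (q - Q)
            linarith
        _ ≤ |q - Q| := div_le_self (abs_nonneg _) hr
    calc m * |Real.log t| * -((q - r) / r) ≤ m * |Real.log t| * |q - Q| :=
          mul_le_mul_of_nonneg_left this (by positivity)
      _ = m * (|q - Q| * |Real.log t|) := by ring
      _ ≤ m * A := mul_le_mul_of_nonneg_left hA hm.le
  have h4 : K ^ q ≤ K ^ M := Real.rpow_le_rpow_of_exponent_le hK hqM
  calc K ^ q * t⁻¹ * (rho * rho ^ ((q - r) / r)) ≤ K ^ M * t⁻¹ * (rho * Real.exp (m * A)) := by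
        gcongr
    _ = _ := by ring

theorem lint_Ioi {t a : ℝ} (ht : 0 < t) (ha : 0 < a) :
    ∫⁻ s in Ioi t, ENNReal.ofReal (s ^ (-a - 1)) = ENNReal.ofReal (t ^ (-a) / a) := by
  rw [← ofReal_integral_eq_lintegral_ofReal]
  · rw [integral_Ioi_rpow_of_lt (by linarith) ht]
    congr 1
    have : -a - 1 + 1 = -a := by ring
    rw [this]; field_simp
  · exact integrableOn_Ioi_rpow_of_lt (by linarith) ht
  · filter_upwards [ae_restrict_mem measurableSet_Ioi] with s hs
    exact Real.rpow_nonneg (ht.trans hs).le _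

theorem lint_Ioc {s a : ℝ} (hs : 0 < s) (ha : 0 < a) :
    ∫⁻ t in Ioc 0 s, ENNReal.ofReal (t ^ (a - 1)) = ENNReal.ofReal (s ^ a / a) := by
  rw [← ofReal_integral_eq_lintegral_ofReal]
  · rw [← intervalIntegral.integral_of_le hs.le, integral_rpow (Or.inl (by linarith))]
    congr 1
    have : a - 1 + 1 = a := by ring
    rw [this, Real.zero_rpow ha.ne']; simp
  · exact (intervalIntegrable_iff_integrableOn_Ioc_of_le hs.le).1
      (intervalIntegral.intervalIntegrable_rpow' (by linarith))
  · filter_upwards [ae_restrict_mem measurableSet_Ioc] with t ht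
    exact Real.rpow_nonneg ht.1.le _

theorem lint_tail {m : ℝ} (hm : 0 < m) :
    ∫⁻ t in Ioi (0:ℝ), ENNReal.ofReal (t⁻¹ * Real.exp (-(m * |Real.log t|)))
      ≤ ENNReal.ofReal (2 / m) := by
  have hU : Ioi (0:ℝ) = Ioc 0 1 ∪ Ioi 1 := (Ioc_union_Ioi_eq_Ioi zero_le_one).symm
  rw [hU]
  refine (lintegral_union_le _ _ _).trans ?_
  have h1 : ∫⁻ t in Ioc (0:ℝ) 1, ENNReal.ofReal (t⁻¹ * Real.exp (-(m * |Real.log t|))) =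
      ∫⁻ t in Ioc (0:ℝ) 1, ENNReal.ofReal (t ^ (m - 1)) := by
    refine setLIntegral_congr_fun measurableSet_Ioc fun t ht => ?_
    congr 1
    rw [abs_of_nonpos (Real.log_nonpos ht.1.le ht.2), Real.rpow_sub_one ht.1.ne',
      Real.rpow_def_of_pos ht.1, div_eq_inv_mul]
    congr 2; ring
  have h2 : ∫⁻ t in Ioi (1:ℝ), ENNReal.ofReal (t⁻¹ * Real.exp (-(m * |Real.log t|))) =
      ∫⁻ t in Ioi (1:ℝ), ENNReal.ofReal (t ^ (-m - 1)) := by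
    refine setLIntegral_congr_fun measurableSet_Ioi fun t ht => ?_
    have ht' : (1:ℝ) < t := ht
    have ht0 : 0 < t := by linarith
    congr 1
    rw [abs_of_pos (Real.log_pos ht'), Real.rpow_sub_one ht0.ne',
      Real.rpow_def_of_pos ht0, div_eq_inv_mul]
    congr 2; ring
  rw [h1, h2, lint_Ioc one_pos hm, lint_Ioi one_pos hm, Real.one_rpow, Real.one_rpow,
    ← ENNReal.ofReal_add (by positivity) (by positivity)]
  refine ENNReal.ofReal_le_ofReal (le_of_eq ?_)
  ring

theorem core {ℓ : ℝ≥0∞} {p q b v : ℝ → ℝ} {P0 Pi Q0 Qi b0 bi v0 vi A M a : ℝ}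
    (mp : Measurable p)
    (hA : 0 ≤ A) (ha : 0 < a)
    (dp : ∀ t ∈ dom ℓ, |p t - stp P0 Pi t| * |Real.log t| ≤ A)
    (dq : ∀ t ∈ dom ℓ, |q t - stp Q0 Qi t| * |Real.log t| ≤ A)
    (db : ∀ t ∈ dom ℓ, |b t - stp b0 bi t| * |Real.log t| ≤ A)
    (dv : ∀ t ∈ dom ℓ, |v t - stp v0 vi t| * |Real.log t| ≤ A)
    (hp : ∀ t ∈ dom ℓ, 1 ≤ p t ∧ p t ≤ M) (hq : ∀ t ∈ dom ℓ, 1 ≤ q t ∧ q t ≤ M)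
    (hP0 : 1 ≤ P0 ∧ P0 ≤ M) (hPi : 1 ≤ Pi ∧ Pi ≤ M) (hQ0 : P0 ≤ Q0) (hQi : Pi ≤ Qi)
    (e0 : 1 / Q0 = 1 / P0 - v0) (ei : 1 / Qi = 1 / Pi - vi)
    (ha0 : a ≤ b0 + 1 / P0) (hai : a ≤ bi + 1 / Pi) :
    ∃ K : ℝ, 1 ≤ K ∧ ∀ f : ℝ → ℝ, Measurable f → (∀ t, 0 ≤ f t) →
      ∫⁻ t in dom ℓ, ENNReal.ofReal (f t) ^ p t ≤ 1 →
      ∫⁻ t in dom ℓ, ENNReal.ofReal |t ^ (b t + v t) *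
            ∫ s in {s : ℝ | t < s ∧ ENNReal.ofReal s < ℓ}, f s / s ^ (b s + 1)| ^ q t
        ≤ ENNReal.ofReal K := by
  have hM : 1 ≤ M := hP0.1.trans hP0.2
  set m := a / (2 * M) with hm
  have hm0 : 0 < m := by positivity
  have hmM : m * M ≤ a / 2 := by rw [hm]; apply le_of_eq; field_simp
  set K1 := Real.exp (5 * A + m * A) * (1 / a + 1) with hK1
  have hK1' : 1 ≤ K1 := by
    have h1 : 1 ≤ Real.exp (5 * A + m * A) := Real.one_le_exp (by positivity)
    have h2 : 1 ≤ 1 / a + 1 := by have : 0 < 1 / a := by positivity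
                                  linarith
    exact one_le_mul_of_one_le_of_one_le h1 h2
  set K2 := K1 ^ M * Real.exp (m * A) with hK2
  have hK2' : 1 ≤ K2 := one_le_mul_of_one_le_of_one_le (Real.one_le_rpow hK1' (by linarith))
    (Real.one_le_exp (by positivity))
  refine ⟨K2 * (2 / a + 2 / m) + 1, by have : 0 ≤ K2 * (2 / a + 2 / m) := by positivity
                                       linarith, ?_⟩
  intro f mf hf hmod
  -- the set of integration
  have hE : ∀ t : ℝ, 0 < t → {s : ℝ | t < s ∧ ENNReal.ofReal s < ℓ} = dom ℓ ∩ Ioi t := by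
    intro t ht
    ext s
    simp only [dom, mem_ofPred_eq, mem_inter_iff, mem_Ioi]
    constructor
    · rintro ⟨h1, h2⟩; exact ⟨⟨ht.trans h1, h2⟩, h1⟩
    · rintro ⟨⟨_, h2⟩, h1⟩; exact ⟨h1, h2⟩
  have hmod' : ∫⁻ s in dom ℓ, ENNReal.ofReal (f s ^ p s) ≤ 1 := by
    refine le_trans (le_of_eq ?_) hmod
    refine setLIntegral_congr_fun (measurableSet_dom ℓ) fun t ht => ?_
    exact (ENNReal.ofReal_rpow_of_nonneg (hf t) (by linarith [(hp t ht).1])).symm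
  have mF : Measurable fun s => ENNReal.ofReal (f s ^ p s) := (mf.pow mp).ennreal_ofReal
  set Phi : ℝ → ℝ≥0∞ := fun t => ∫⁻ s in dom ℓ ∩ Ioi t,
    ENNReal.ofReal ((t / s) ^ (a / 2) * f s ^ p s) with hPhi
  have hPhi1 : ∀ t, 0 < t → Phi t ≤ 1 := by
    intro t ht
    refine le_trans ?_ hmod'
    refine le_trans ?_ (lintegral_mono_set inter_subset_left : 
      ∫⁻ s in dom ℓ ∩ Ioi t, ENNReal.ofReal (f s ^ p s) ≤ _)
    refine setLIntegral_mono mF fun s hs => ENNReal.ofReal_le_ofReal ?_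
    have hts : t < s := hs.2
    have hs0 : 0 < s := hs.1.1
    have : (t / s) ^ (a / 2) ≤ 1 :=
      Real.rpow_le_one (by positivity) ((div_le_one hs0).2 hts.le) (by positivity)
    have h2 := Real.rpow_nonneg (hf s) (p s)
    nlinarith
  -- the main pointwise bound
  have key : ∀ t ∈ dom ℓ, ENNReal.ofReal |t ^ (b t + v t) *
            ∫ s in {s : ℝ | t < s ∧ ENNReal.ofReal s < ℓ}, f s / s ^ (b s + 1)| ^ q t
        ≤ ENNReal.ofReal K2 * (ENNReal.ofReal t⁻¹ * Phi t +
          ENNReal.ofReal (t⁻¹ * Real.exp (-(m * |Real.log t|)))) := by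
    intro t ht
    have ht0 : 0 < t := ht.1
    have hst : ∀ x, 1 ≤ stp P0 Pi x ∧ stp P0 Pi x ≤ M := by
      intro x; unfold stp; split_ifs <;> assumption
    have hstQ : ∀ x, stp P0 Pi x ≤ stp Q0 Qi x := by
      intro x; unfold stp; split_ifs <;> assumption
    have hPf := ne_top_of_le_ne_top ENNReal.one_ne_top (hPhi1 t ht0)
    set rho := max (Phi t).toReal (Real.exp (-(m * |Real.log t|))) with hrho
    have h0 : Real.exp (-(m * |Real.log t|)) ≤ rho := le_max_right _ _
    have h1 : rho ≤ 1 := by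
      refine max_le ?_ ?_
      · exact ENNReal.toReal_le_of_le_ofReal zero_le_one (by simpa using hPhi1 t ht0)
      · rw [Real.exp_le_one_iff]
        have : 0 ≤ m * |Real.log t| := by positivity
        linarith
    have hr0 : 0 < rho := (Real.exp_pos _).trans_le h0
    have hPr : Phi t ≤ ENNReal.ofReal rho := by
      rw [← ENNReal.ofReal_toReal hPf]
      exact ENNReal.ofReal_le_ofReal (le_max_left _ _)
    have hb1 : ENNReal.ofReal |t ^ (b t + v t) *
            ∫ s in {s : ℝ | t < s ∧ ENNReal.ofReal s < ℓ}, f s / s ^ (b s + 1)| ≤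
          ENNReal.ofReal (K1 * t ^ (-(1 / q t)) * rho ^ (1 / stp P0 Pi t)) := by
      rw [hE t ht0, ← integral_const_mul, ← Real.enorm_eq_ofReal_abs]
      refine (enorm_integral_le_lintegral_enorm _).trans ?_
      set Z := Real.exp (5 * A + m * A) * t ^ (-(1 / q t)) * rho ^ (1 / stp P0 Pi t) with hZ
      have hZ0 : 0 ≤ Z := by positivity
      have mk1 : Measurable fun s : ℝ => ENNReal.ofReal ((t / s) ^ a * s⁻¹) := by
        apply Measurable.ennreal_ofReal
        exact ((measurable_const.div measurable_id).pow_const _).mul measurable_id.inv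
      have mk2 : Measurable fun s : ℝ => ENNReal.ofReal ((t / s) ^ (a / 2) * f s ^ p s) := by
        apply Measurable.ennreal_ofReal
        exact ((measurable_const.div measurable_id).pow_const _).mul (mf.pow mp)
      calc ∫⁻ s in dom ℓ ∩ Ioi t, ‖t ^ (b t + v t) * (f s / s ^ (b s + 1))‖ₑ
          ≤ ∫⁻ s in dom ℓ ∩ Ioi t, ENNReal.ofReal Z * (ENNReal.ofReal ((t / s) ^ a * s⁻¹) +
              ENNReal.ofReal rho⁻¹ * ENNReal.ofReal ((t / s) ^ (a / 2) * f s ^ p s)) := by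
            refine setLIntegral_mono ((mk1.add (mk2.const_mul _)).const_mul _) fun s hs => ?_
            have hts : t < s := hs.2
            have hs0 : 0 < s := hs.1.1
            have hfs := hf s
            have hn1 : 0 ≤ (t / s) ^ a * s⁻¹ := by positivity
            have hn2 : 0 ≤ (t / s) ^ (a / 2) * f s ^ p s := by positivity
            rw [← ENNReal.ofReal_mul (by positivity), ← ENNReal.ofReal_add hn1 (by positivity),
              ← ENNReal.ofReal_mul hZ0, Real.enorm_eq_ofReal (by positivity)]
            refine ENNReal.ofReal_le_ofReal ?_
            refine pointwise ht0 hs0 (hf s) (M := M) ?_ ?_ hts hm0 hmM hA ha (hst t).1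
              (hp s hs.1).1 h0 h1
            · refine kernel_exp (db t ht) (dv t ht) (dq t ht) (db s hs.1) (dp s hs.1)
                (hq t ht).1 ((hst t).1.trans (hstQ t)) (hp s hs.1).1 (hst s).1 (Pt := stp P0 Pi t)
                ?_ (cmp_stp ht0 hts ha0 hai)
              unfold stp; split_ifs <;> assumption
            · exact cross_stp ht0 hts (dp s hs.1) hA (by linarith [(hp s hs.1).1]) (hp s hs.1).2
                (by linarith [hP0.1]) hP0.2 (by linarith [hPi.1]) hPi.2
        _ = ENNReal.ofReal Z * ((∫⁻ s in dom ℓ ∩ Ioi t, ENNReal.ofReal ((t / s) ^ a * s⁻¹)) +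
              ENNReal.ofReal rho⁻¹ * Phi t) := by
            rw [lintegral_const_mul' _ _ ENNReal.ofReal_ne_top, lintegral_add_left mk1,
              lintegral_const_mul _ mk2]
        _ ≤ ENNReal.ofReal Z * (ENNReal.ofReal (1 / a) + 1) := by
            gcongr
            · refine (lintegral_mono_set inter_subset_right).trans ?_
              have : ∫⁻ s in Ioi t, ENNReal.ofReal ((t / s) ^ a * s⁻¹) =
                  ∫⁻ s in Ioi t, ENNReal.ofReal (t ^ a) * ENNReal.ofReal (s ^ (-a - 1)) := by
                refine setLIntegral_congr_fun measurableSet_Ioi fun s hs => ?_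
                have hs0 : 0 < s := ht0.trans hs
                rw [← ENNReal.ofReal_mul (by positivity), Real.div_rpow ht0.le hs0.le,
                  Real.rpow_sub_one hs0.ne', Real.rpow_neg hs0.le]
                congr 1; field_simp
              rw [this, lintegral_const_mul _ (by fun_prop), lint_Ioi ht0 ha,
                ← ENNReal.ofReal_mul (by positivity)]
              refine ENNReal.ofReal_le_ofReal (le_of_eq ?_)
              rw [Real.rpow_neg ht0.le]
              field_simp
            · calc ENNReal.ofReal rho⁻¹ * Phi t ≤ ENNReal.ofReal rho⁻¹ * ENNReal.ofReal rho := by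
                    gcongr
                _ = 1 := by
                    rw [← ENNReal.ofReal_mul (by positivity), inv_mul_cancel₀ hr0.ne']; simp
        _ = _ := by
            rw [← ENNReal.ofReal_one, ← ENNReal.ofReal_add (by positivity) zero_le_one,
              ← ENNReal.ofReal_mul hZ0]
            congr 1
            rw [hZ, hK1]; ring
    have hq0 : 0 ≤ q t := by linarith [(hq t ht).1]
    refine (ENNReal.rpow_le_rpow hb1 hq0).trans ?_
    rw [ENNReal.ofReal_rpow_of_nonneg (by positivity) hq0]
    refine (ENNReal.ofReal_le_ofReal (final_pow ht0 (hq t ht).1 (hq t ht).2 (hst t).1 (hstQ t)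
      (dq t ht) hA hm0 hK1' h0 h1)).trans ?_
    rw [ENNReal.ofReal_mul (by positivity)]
    gcongr
    rw [ENNReal.ofReal_mul (by positivity), ENNReal.ofReal_mul (by positivity), ← mul_add]
    gcongr
    rw [hrho, ENNReal.ofReal_max]
    refine max_le ?_ ?_
    · rw [ENNReal.ofReal_toReal hPf]; exact le_self_add
    · exact le_add_self
  -- Tonelli
  have hTon : ∫⁻ t in dom ℓ, ENNReal.ofReal t⁻¹ * Phi t ≤ ENNReal.ofReal (2 / a) := by
    set k : ℝ → ℝ → ℝ≥0∞ := fun t s =>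
      (Ioi t).indicator (fun s => ENNReal.ofReal (t⁻¹ * (t / s) ^ (a / 2))) s *
        ENNReal.ofReal (f s ^ p s) with hk
    have e1 : ∫⁻ t in dom ℓ, ENNReal.ofReal t⁻¹ * Phi t = ∫⁻ t in dom ℓ, ∫⁻ s in dom ℓ, k t s := by
      refine setLIntegral_congr_fun (measurableSet_dom ℓ) fun t ht => ?_
      have ht0 : 0 < t := ht.1
      simp only [hPhi, hk]
      rw [← lintegral_const_mul' _ _ ENNReal.ofReal_ne_top, inter_comm,
        ← Measure.restrict_restrict measurableSet_Ioi, ← lintegral_indicator measurableSet_Ioi]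
      refine setLIntegral_congr_fun (measurableSet_dom ℓ) fun s hs => ?_
      have hs0 : 0 < s := hs.1
      by_cases hts : s ∈ Ioi t
      · simp only [indicator_of_mem hts]
        have := hf s
        rw [← ENNReal.ofReal_mul (by positivity), ← ENNReal.ofReal_mul (by positivity), mul_assoc]
      · simp only [indicator_of_notMem hts, zero_mul]
    have mk : Measurable (Function.uncurry k) := by
      have : Function.uncurry k = fun z : ℝ × ℝ =>
          {z : ℝ × ℝ | z.1 < z.2}.indicator
            (fun z => ENNReal.ofReal (z.1⁻¹ * (z.1 / z.2) ^ (a / 2))) z *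
          ENNReal.ofReal (f z.2 ^ p z.2) := by
        funext z
        rfl
      rw [this]
      refine Measurable.mul ?_ ?_
      · refine Measurable.indicator ?_ (measurableSet_lt measurable_fst measurable_snd)
        fun_prop
      · exact mF.comp measurable_snd
    rw [e1, lintegral_lintegral_swap mk.aemeasurable]
    calc ∫⁻ s in dom ℓ, ∫⁻ t in dom ℓ, k t s
        ≤ ∫⁻ s in dom ℓ, ENNReal.ofReal (2 / a) * ENNReal.ofReal (f s ^ p s) := by
          refine setLIntegral_mono (mF.const_mul _) fun s hs => ?_
          have hs0 : 0 < s := hs.1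
          simp only [hk]
          rw [lintegral_mul_const' _ _ ENNReal.ofReal_ne_top]
          gcongr
          calc ∫⁻ t in dom ℓ, (Ioi t).indicator
                  (fun s => ENNReal.ofReal (t⁻¹ * (t / s) ^ (a / 2))) s
              ≤ ∫⁻ t in Ioi 0, (Iio s).indicator
                  (fun t => ENNReal.ofReal (t⁻¹ * (t / s) ^ (a / 2))) t := by
                refine le_trans (lintegral_mono_set (fun t ht => ht.1)) (le_of_eq ?_)
                rfl
            _ = ∫⁻ t in Iio s ∩ Ioi 0, ENNReal.ofReal (t⁻¹ * (t / s) ^ (a / 2)) := by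
                rw [lintegral_indicator measurableSet_Iio,
                  Measure.restrict_restrict measurableSet_Iio]
            _ ≤ ∫⁻ t in Ioc 0 s, ENNReal.ofReal (t⁻¹ * (t / s) ^ (a / 2)) :=
                lintegral_mono_set fun t ht => ⟨ht.2, (mem_Iio.1 ht.1).le⟩
            _ = ∫⁻ t in Ioc 0 s, ENNReal.ofReal (s ^ (-(a / 2))) *
                  ENNReal.ofReal (t ^ (a / 2 - 1)) := by
                refine setLIntegral_congr_fun measurableSet_Ioc fun t ht => ?_
                have ht0 : 0 < t := ht.1
                rw [← ENNReal.ofReal_mul (by positivity), Real.div_rpow ht0.le hs0.le,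
                  Real.rpow_sub_one ht0.ne', Real.rpow_neg hs0.le]
                congr 1; field_simp
            _ = ENNReal.ofReal (2 / a) := by
                rw [lintegral_const_mul _ (by fun_prop), lint_Ioc hs0 (by positivity),
                  ← ENNReal.ofReal_mul (by positivity), Real.rpow_neg hs0.le]
                congr 1
                field_simp
      _ = ENNReal.ofReal (2 / a) * ∫⁻ s in dom ℓ, ENNReal.ofReal (f s ^ p s) :=
          lintegral_const_mul _ mF
      _ ≤ ENNReal.ofReal (2 / a) * 1 := by gcongr
      _ = _ := mul_one _
  have mT : Measurable fun t : ℝ => ENNReal.ofReal (t⁻¹ * Real.exp (-(m * |Real.log t|))) := by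
    apply Measurable.ennreal_ofReal
    refine measurable_id.inv.mul (Real.measurable_exp.comp ?_)
    exact ((Real.measurable_log.abs).const_mul m).neg
  calc _ ≤ ∫⁻ t in dom ℓ, ENNReal.ofReal K2 * (ENNReal.ofReal t⁻¹ * Phi t +
          ENNReal.ofReal (t⁻¹ * Real.exp (-(m * |Real.log t|)))) :=
        setLIntegral_mono' (measurableSet_dom ℓ) key
    _ = ENNReal.ofReal K2 * ((∫⁻ t in dom ℓ, ENNReal.ofReal t⁻¹ * Phi t) +
          ∫⁻ t in dom ℓ, ENNReal.ofReal (t⁻¹ * Real.exp (-(m * |Real.log t|)))) := by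
        rw [lintegral_const_mul' _ _ ENNReal.ofReal_ne_top, lintegral_add_right _ mT]
    _ ≤ ENNReal.ofReal K2 * (ENNReal.ofReal (2 / a) + ENNReal.ofReal (2 / m)) := by
        gcongr
        exact (lintegral_mono_set fun t ht => ht.1).trans (lint_tail hm0)
    _ ≤ _ := by
        rw [← ENNReal.ofReal_add (by positivity) (by positivity),
          ← ENNReal.ofReal_mul (by positivity)]
        exact ENNReal.ofReal_le_ofReal (by linarith)

theorem lux_mod {ℓ : ℝ≥0∞} {q g : ℝ → ℝ} (hq : ∀ t ∈ dom ℓ, 1 ≤ q t) {lam : ℝ}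
    (hl : 0 < lam) (h : luxNorm ℓ q g < ENNReal.ofReal lam) :
    ∫⁻ t in dom ℓ, ENNReal.ofReal (|g t| / lam) ^ q t ≤ 1 := by
  unfold luxNorm at h
  obtain ⟨mu, ⟨_, hmu⟩, hlt⟩ := sInf_lt_iff.1 h
  refine le_trans ?_ hmu
  refine setLIntegral_mono' (measurableSet_dom ℓ) fun t ht => ?_
  refine ENNReal.rpow_le_rpow ?_ (by linarith [hq t ht])
  rw [ENNReal.ofReal_div_of_pos hl]
  exact ENNReal.div_le_div_left hlt.le _

theorem lower {ℓ : ℝ≥0∞} {q : ℝ → ℝ} {Q0 Qi A M kap : ℝ}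
    (dq : ∀ t ∈ dom ℓ, |q t - stp Q0 Qi t| * |Real.log t| ≤ A)
    (hq : ∀ t ∈ dom ℓ, 1 ≤ q t ∧ q t ≤ M) (hA : 0 ≤ A)
    (hQ0 : 1 ≤ Q0) (hQi : 1 ≤ Qi) (hk : 0 < kap) :
    ∃ k' : ℝ, 0 < k' ∧ ∀ (h : ℝ → ℝ) (x y : ℝ), 0 < x → x ≤ y →
      (∀ t ∈ Ioo x y, t ∈ dom ℓ ∧ kap * t ^ (-(1 / stp Q0 Qi t)) ≤ h t) →
      ∫⁻ t in dom ℓ, ENNReal.ofReal (h t) ^ q t ≤ 1 → k' * Real.log (y / x) ≤ 1 := by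
  set m1 := min kap 1 with hm1
  have hm0 : 0 < m1 := lt_min hk one_pos
  set k' := m1 ^ M * Real.exp (-A) with hk'
  have hk0 : 0 < k' := by positivity
  refine ⟨k', hk0, ?_⟩
  intro h x y hx hxy hh hmod
  have hpt : ∀ t ∈ Ioo x y, ENNReal.ofReal (k' * t⁻¹) ≤ ENNReal.ofReal (h t) ^ q t := by
    intro t ht
    obtain ⟨hd, hb⟩ := hh t ht
    have ht0 : 0 < t := hd.1
    have hq1 := hq t hd
    have hst : 1 ≤ stp Q0 Qi t := by unfold stp; split_ifs <;> assumption
    set Q := stp Q0 Qi t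
    have hpos : 0 ≤ kap * t ^ (-(1 / Q)) := by positivity
    rw [ENNReal.ofReal_rpow_of_nonneg (hpos.trans hb) (by linarith)]
    refine ENNReal.ofReal_le_ofReal ?_
    refine le_trans ?_ (Real.rpow_le_rpow hpos hb (by linarith))
    rw [Real.mul_rpow hk.le (by positivity), ← Real.rpow_mul ht0.le, hk', mul_assoc]
    have h1 : m1 ^ M ≤ kap ^ q t :=
      (Real.rpow_le_rpow_of_exponent_ge hm0 (min_le_right _ _) hq1.2).trans
        (Real.rpow_le_rpow hm0.le (min_le_left _ _) (by linarith))
    have h2 : Real.exp (-A) * t⁻¹ ≤ t ^ (-(1 / Q) * q t) := by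
      rw [← Real.exp_log (inv_pos.2 ht0), Real.log_inv, Real.rpow_def_of_pos ht0, ← Real.exp_add,
        Real.exp_le_exp]
      have h3 := (close_mul (dq t hd)).1
      have h4 : (Real.log t * q t) / Q ≤ (Real.log t * Q + A) / Q := by gcongr
      have h5 : (Real.log t * Q + A) / Q = Real.log t + A / Q := by field_simp
      have h6 : A / Q ≤ A := div_le_self hA hst
      have h7 : Real.log t * (-(1 / Q) * q t) = - ((Real.log t * q t) / Q) := by ring
      rw [h7]; linarith
    exact mul_le_mul h1 h2 (by positivity) (by positivity)
  have hint : ∫⁻ t in Ioc x y, ENNReal.ofReal (k' * t⁻¹) =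
      ENNReal.ofReal (k' * Real.log (y / x)) := by
    rw [← ofReal_integral_eq_lintegral_ofReal]
    · rw [← intervalIntegral.integral_of_le hxy, intervalIntegral.integral_const_mul,
        integral_inv_of_pos hx (hx.trans_le hxy)]
    · refine (intervalIntegrable_iff_integrableOn_Ioc_of_le hxy).1 ?_
      refine IntervalIntegrable.const_mul ?_ _
      refine intervalIntegral.intervalIntegrable_inv (fun t ht => ?_) continuousOn_id
      rw [uIcc_of_le hxy] at ht
      exact (hx.trans_le ht.1).ne'
    · filter_upwards [ae_restrict_mem measurableSet_Ioc] with t ht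
      have : 0 < t := hx.trans ht.1
      simp only [Pi.zero_apply]
      positivity
  have : ENNReal.ofReal (k' * Real.log (y / x)) ≤ 1 := by
    rw [← hint, ← restrict_Ioo_eq_restrict_Ioc]
    calc ∫⁻ t in Ioo x y, ENNReal.ofReal (k' * t⁻¹)
        ≤ ∫⁻ t in Ioo x y, ENNReal.ofReal (h t) ^ q t := setLIntegral_mono' measurableSet_Ioo hpt
      _ ≤ ∫⁻ t in dom ℓ, ENNReal.ofReal (h t) ^ q t := lintegral_mono_set fun t ht => (hh t ht).1
      _ ≤ 1 := hmod
  rwa [ENNReal.ofReal_le_one] at this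

theorem nec {ℓ C : ℝ≥0∞} {p q b v : ℝ → ℝ} {M N lam mu : ℝ} (hC0 : 0 < C) (hC : C < ∞)
    (H : ∀ f : ℝ → ℝ, Measurable f → (∀ t, 0 ≤ f t) →
        luxNorm ℓ p f < ∞ →
        luxNorm ℓ q (fun t => t ^ (b t + v t) *
            ∫ s in {s : ℝ | t < s ∧ ENNReal.ofReal s < ℓ}, f s / s ^ (b s + 1))
          ≤ C * luxNorm ℓ p f)
    (mb : Measurable b) (hb : ∀ t ∈ dom ℓ, |b t| ≤ M)
    (hp : ∀ t ∈ dom ℓ, 1 ≤ p t) (hq : ∀ t ∈ dom ℓ, 1 ≤ q t)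
    (hN : 0 < N) (hsub : ∀ s ∈ Icc N (2 * N), s ∈ dom ℓ) (hlam : 0 < lam)
    (h1 : ∀ s ∈ Icc N (2 * N), (1 / lam) ^ p s ≤ 1 / N)
    (hmu : ∀ s ∈ Icc N (2 * N), mu ≤ (s ^ (b s + 1))⁻¹) :
    ∃ g : ℝ → ℝ, ∫⁻ t in dom ℓ, ENNReal.ofReal (g t) ^ q t ≤ 1 ∧
      ∀ t, 0 < t → t < N → t ^ (b t + v t) * (N * mu) / (2 * C.toReal * lam) ≤ g t := by
  have hCr : 0 < C.toReal := ENNReal.toReal_pos hC0.ne' hC.ne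
  set f : ℝ → ℝ := (Icc N (2 * N)).indicator (fun _ => 1) with hf
  have mf : Measurable f := measurable_const.indicator measurableSet_Icc
  have hf0 : ∀ t, 0 ≤ f t := fun t => indicator_nonneg (fun _ _ => zero_le_one) t
  have hlux : luxNorm ℓ p f ≤ ENNReal.ofReal lam := by
    refine sInf_le ⟨ENNReal.ofReal_pos.2 hlam, ?_⟩
    change ∫⁻ t in dom ℓ, _ ≤ _
    calc ∫⁻ t in dom ℓ, (ENNReal.ofReal |f t| / ENNReal.ofReal lam) ^ p t
        ≤ ∫⁻ t in dom ℓ, (Icc N (2 * N)).indicator (fun _ => ENNReal.ofReal (1 / N)) t := by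
          refine setLIntegral_mono' (measurableSet_dom ℓ) fun t ht => ?_
          have hpt : 0 < p t := by linarith [hp t ht]
          by_cases hm : t ∈ Icc N (2 * N)
          · simp only [hf, indicator_of_mem hm]
            rw [← ENNReal.ofReal_div_of_pos hlam, abs_one,
              ENNReal.ofReal_rpow_of_nonneg (by positivity) hpt.le]
            exact ENNReal.ofReal_le_ofReal (h1 t hm)
          · simp [hf, indicator_of_notMem hm, hpt]
      _ ≤ ∫⁻ t, (Icc N (2 * N)).indicator (fun _ => ENNReal.ofReal (1 / N)) t :=
          setLIntegral_le_lintegral _ _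
      _ = ENNReal.ofReal (1 / N) * ENNReal.ofReal (2 * N - N) := by
          rw [lintegral_indicator measurableSet_Icc, setLIntegral_const, Real.volume_Icc]
      _ = 1 := by
          rw [← ENNReal.ofReal_mul (by positivity)]
          have : 1 / N * (2 * N - N) = 1 := by field_simp; ring
          rw [this, ENNReal.ofReal_one]
  have hT := H f mf hf0 (hlux.trans_lt ENNReal.ofReal_lt_top)
  have hT2 : luxNorm ℓ q (fun t => t ^ (b t + v t) *
            ∫ s in {s : ℝ | t < s ∧ ENNReal.ofReal s < ℓ}, f s / s ^ (b s + 1)) <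
      ENNReal.ofReal (2 * C.toReal * lam) := by
    refine hT.trans_lt ?_
    calc C * luxNorm ℓ p f ≤ ENNReal.ofReal C.toReal * ENNReal.ofReal lam := by
          rw [ENNReal.ofReal_toReal hC.ne]; gcongr
      _ = ENNReal.ofReal (C.toReal * lam) := (ENNReal.ofReal_mul hCr.le).symm
      _ < _ := by
          have : 0 < C.toReal * lam := by positivity
          exact (ENNReal.ofReal_lt_ofReal_iff (by positivity)).2 (by linarith)
  refine ⟨_, lux_mod hq (by positivity) hT2, ?_⟩
  intro t ht0 htN
  have hI : N * mu ≤ ∫ s in {s : ℝ | t < s ∧ ENNReal.ofReal s < ℓ}, f s / s ^ (b s + 1) := by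
    have e : (fun s => f s / s ^ (b s + 1)) =
        (Icc N (2 * N)).indicator (fun s => (s ^ (b s + 1))⁻¹) := by
      funext s
      by_cases hm : s ∈ Icc N (2 * N)
      · simp [hf, indicator_of_mem hm]
      · simp [hf, indicator_of_notMem hm]
    have e2 : {s : ℝ | t < s ∧ ENNReal.ofReal s < ℓ} ∩ Icc N (2 * N) = Icc N (2 * N) :=
      inter_eq_right.2 fun s hs => ⟨htN.trans_le hs.1, (hsub s hs).2⟩
    rw [e, setIntegral_indicator measurableSet_Icc, e2]
    have hint : IntegrableOn (fun s => (s ^ (b s + 1))⁻¹) (Icc N (2 * N)) := by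
      refine Measure.integrableOn_of_bounded
        (M := Real.exp ((|Real.log N| + |Real.log (2 * N)|) * (M + 1))) ?_ ?_ ?_
      · simp
      · exact ((measurable_id.pow (mb.add_const 1)).inv).aestronglyMeasurable
      · filter_upwards [ae_restrict_mem measurableSet_Icc] with s hs
        have hs0 : 0 < s := hN.trans_le hs.1
        have hbs := hb s (hsub s hs)
        have hbs' := abs_le.1 hbs
        rw [Real.norm_of_nonneg (by positivity), ← Real.rpow_neg hs0.le,
          Real.rpow_def_of_pos hs0, Real.exp_le_exp]
        have l1 := Real.log_le_log hN hs.1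
        have l2 := Real.log_le_log hs0 hs.2
        have l3 : |Real.log s| ≤ |Real.log N| + |Real.log (2 * N)| := by
          refine abs_le.2 ⟨?_, ?_⟩
          · linarith [neg_abs_le (Real.log N), abs_nonneg (Real.log (2 * N))]
          · linarith [le_abs_self (Real.log (2 * N)), abs_nonneg (Real.log N)]
        have l4 : |-(b s + 1)| ≤ M + 1 := abs_le.2 ⟨by linarith, by linarith⟩
        calc Real.log s * -(b s + 1) ≤ |Real.log s * -(b s + 1)| := le_abs_self _
          _ = |Real.log s| * |-(b s + 1)| := abs_mul _ _
          _ ≤ _ := mul_le_mul l3 l4 (abs_nonneg _) (by positivity)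
    have := setIntegral_mono_on (f := fun _ => mu) (by simp [integrableOn_const_iff]) hint
      measurableSet_Icc hmu
    refine le_trans (le_of_eq ?_) this
    rw [setIntegral_const, Real.volume_real_Icc, max_eq_left (by linarith), smul_eq_mul]
    ring
  have htp : 0 < t ^ (b t + v t) := Real.rpow_pos_of_pos ht0 _
  have := mul_le_mul_of_nonneg_left hI htp.le
  have h3 := this.trans (le_abs_self _)
  exact div_le_div_of_nonneg_right h3 (by positivity)

theorem lim_bounds {ℓ : ℝ≥0∞} (hℓ : 0 < ℓ) {p : ℝ → ℝ} {p0 pinf pm pM : ℝ}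
    (h : ClassP ℓ p p0 pinf)
    (hb : ∀ t : ℝ, 0 ≤ t → ENNReal.ofReal t ≤ ℓ → pm ≤ p t ∧ p t ≤ pM) :
    (pm ≤ p0 ∧ p0 ≤ pM) ∧ (ℓ = ∞ → pm ≤ pinf ∧ pinf ≤ pM) := by
  constructor
  · have : ∀ᶠ t in nhdsWithin (0:ℝ) (Ioi 0), pm ≤ p t ∧ p t ≤ pM := by
      have h1 : Tendsto ENNReal.ofReal (nhdsWithin (0:ℝ) (Ioi 0)) (nhds 0) := by
        have := (ENNReal.continuous_ofReal.tendsto 0).mono_left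
          (nhdsWithin_le_nhds (s := Ioi (0:ℝ)))
        simpa using this
      filter_upwards [h1.eventually (gt_mem_nhds hℓ), self_mem_nhdsWithin] with t h2 h3
      exact hb t (le_of_lt h3) h2.le
    exact ⟨ge_of_tendsto h.lim_zero (this.mono fun _ h => h.1),
      le_of_tendsto h.lim_zero (this.mono fun _ h => h.2)⟩
  · intro hl
    have : ∀ᶠ t in atTop, pm ≤ p t ∧ p t ≤ pM := by
      filter_upwards [eventually_ge_atTop (0:ℝ)] with t ht
      exact hb t ht (by simp [hl])
    exact ⟨ge_of_tendsto (h.lim_infty hl) (this.mono fun _ h => h.1),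
      le_of_tendsto (h.lim_infty hl) (this.mono fun _ h => h.2)⟩

set_option maxHeartbeats 2000000 in
/-- Theorem 2.2, second Hardy inequality.  For `p ∈ P₁([0,ℓ])`,
`β, ν ∈ P([0,ℓ])` with `0 ≤ ν(0) < 1/p(0)` (and at `∞` if `ℓ = ∞`), and `q ∈ P₁([0,ℓ])`
with `1/q(0) = 1/p(0) − ν(0)` (and at `∞` if `ℓ = ∞`), the Hardy inequality
`‖t^{β(t)+ν(t)} ∫ₜ^ℓ f(s) s^{−β(s)−1} ds‖_{q(·)} ≤ C ‖f‖_{p(·)}` holds for all nonnegative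
`f ∈ L^{p(·)}([0,ℓ])` iff `β(0) > −1/p(0)` (and `β(∞) > −1/p(∞)` if `ℓ = ∞`). -/
theorem statement1 (ℓ : ℝ≥0∞) (hℓ : 0 < ℓ)
    (p q b v : ℝ → ℝ) (p0 pinf q0 qinf b0 binf v0 vinf : ℝ)
    (hp : ClassPa 1 ℓ p p0 pinf) (hq : ClassPa 1 ℓ q q0 qinf)
    (hb : ClassP ℓ b b0 binf) (hv : ClassP ℓ v v0 vinf)
    (hv0 : 0 ≤ v0 ∧ v0 < 1 / p0)
    (hvinf : ℓ = ∞ → 0 ≤ vinf ∧ vinf < 1 / pinf)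
    (hq0 : 1 / q0 = 1 / p0 - v0)
    (hqinf : ℓ = ∞ → 1 / qinf = 1 / pinf - vinf) :
    (∃ C : ℝ≥0∞, 0 < C ∧ C < ∞ ∧ ∀ f : ℝ → ℝ, Measurable f → (∀ t, 0 ≤ f t) →
        luxNorm ℓ p f < ∞ →
        luxNorm ℓ q (fun t => t ^ (b t + v t) *
            ∫ s in {s : ℝ | t < s ∧ ENNReal.ofReal s < ℓ}, f s / s ^ (b s + 1))
          ≤ C * luxNorm ℓ p f) ↔
      (-(1 / p0) < b0 ∧ (ℓ = ∞ → -(1 / pinf) < binf)) := by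
  obtain ⟨hpP, pm, pM, hpm, hpb⟩ := hp
  obtain ⟨hqP, qm, qM, hqm, hqb⟩ := hq
  obtain ⟨A1, hA1, dp⟩ := decay_aux hpP
  obtain ⟨A2, hA2, dq⟩ := decay_aux hqP
  obtain ⟨A3, hA3, db⟩ := decay_aux hb
  obtain ⟨A4, hA4, dv⟩ := decay_aux hv
  obtain ⟨⟨hp0, hp0'⟩, hpi⟩ := lim_bounds hℓ hpP hpb
  obtain ⟨⟨hq0l, hq0'⟩, hqi⟩ := lim_bounds hℓ hqP hqb
  set A := A1 + A2 + A3 + A4 with hA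
  have hA0 : 0 ≤ A := by positivity
  replace dp := fun t ht => (dp t ht).trans (show A1 ≤ A by linarith)
  replace dq := fun t ht => (dq t ht).trans (show A2 ≤ A by linarith)
  replace db := fun t ht => (db t ht).trans (show A3 ≤ A by linarith)
  replace dv := fun t ht => (dv t ht).trans (show A4 ≤ A by linarith)
  set Pi := if ℓ = ∞ then pinf else p0 with hPi
  set Qi := if ℓ = ∞ then qinf else q0 with hQi
  set Bi := if ℓ = ∞ then binf else b0 with hBi
  set Vi := if ℓ = ∞ then vinf else v0 with hVi
  have hPi1 : 1 ≤ Pi ∧ Pi ≤ pM := by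
    rw [hPi]; split_ifs with hl
    · exact ⟨by linarith [(hpi hl).1], (hpi hl).2⟩
    · exact ⟨by linarith, hp0'⟩
  have hQi1 : 1 ≤ Qi := by
    rw [hQi]; split_ifs with hl
    · linarith [(hqi hl).1]
    · linarith
  have hVi0 : 0 ≤ Vi := by
    rw [hVi]; split_ifs with hl
    · exact (hvinf hl).1
    · exact hv0.1
  have hei : 1 / Qi = 1 / Pi - Vi := by
    rw [hQi, hPi, hVi]; split_ifs with hl
    · exact hqinf hl
    · exact hq0
  have hpd : ∀ t ∈ dom ℓ, 1 ≤ p t ∧ p t ≤ max pM qM := fun t ht => by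
    have := hpb t ht.1.le ht.2.le
    exact ⟨by linarith, this.2.trans (le_max_left _ _)⟩
  have hqd : ∀ t ∈ dom ℓ, 1 ≤ q t ∧ q t ≤ max pM qM := fun t ht => by
    have := hqb t ht.1.le ht.2.le
    exact ⟨by linarith, this.2.trans (le_max_right _ _)⟩
  constructor
  · -- necessity
    rintro ⟨C, hC0, hC, H⟩
    have hCr : 0 < C.toReal := ENNReal.toReal_pos hC0.ne' hC.ne
    obtain ⟨MB, hMB⟩ := hb.bounded
    have hMB' : ∀ t ∈ dom ℓ, |b t| ≤ MB := fun t ht => hMB t ht.1.le ht.2.le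
    have hp1 : ∀ t ∈ dom ℓ, 1 ≤ p t := fun t ht => (hpd t ht).1
    have hq1 : ∀ t ∈ dom ℓ, 1 ≤ q t := fun t ht => (hqd t ht).1
    constructor
    · by_contra hcon
      push Not at hcon
      obtain ⟨c, hc0, hc1, hc2⟩ : ∃ c : ℝ, 0 < c ∧ c ≤ 1 / 2 ∧ ENNReal.ofReal (2 * c) < ℓ := by
        by_cases hl : ℓ = ∞
        · exact ⟨1 / 2, by norm_num, le_rfl, by simp [hl]⟩
        · have hlr := ENNReal.toReal_pos hℓ.ne' hl
          refine ⟨min (1 / 2) (ℓ.toReal / 3), lt_min (by norm_num) (by positivity),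
            min_le_left _ _, ?_⟩
          rw [ENNReal.ofReal_lt_iff_lt_toReal (by positivity) hl]
          have := min_le_right (1 / 2) (ℓ.toReal / 3)
          linarith
      have hsub : ∀ s, 0 < s → s ≤ 2 * c → s ∈ dom ℓ := fun s hs hs2 =>
        ⟨hs, (ENNReal.ofReal_le_ofReal hs2).trans_lt hc2⟩
      have hMB0 : 0 ≤ MB := (abs_nonneg _).trans (hMB' c (hsub c hc0 (by linarith)))
      set mu := Real.exp (-((-Real.log c) * (MB + 1))) with hmu
      obtain ⟨g, hg1, hg2⟩ := nec (N := c) (lam := 1) (mu := mu) hC0 hC H hb.measurable hMB' hp1 hq1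
        hc0 (fun s hs => hsub s (hc0.trans_le hs.1) hs.2) one_pos
        (by
          intro s _
          simp only [div_one, Real.one_rpow]
          rw [le_div_iff₀ hc0]; linarith)
        (by
          intro s hs
          have hs0 : 0 < s := hc0.trans_le hs.1
          have hbs := abs_le.1 (hMB' s (hsub s hs0 hs.2))
          rw [← Real.rpow_neg hs0.le, Real.rpow_def_of_pos hs0, hmu, Real.exp_le_exp]
          have l1 := Real.log_le_log hc0 hs.1
          have l2 : Real.log s ≤ 0 := Real.log_nonpos hs0.le (by linarith [hs.2])
          nlinarith)
      have hkap : 0 < Real.exp (-(2 * A)) * (c * mu) / (2 * C.toReal * 1) := by positivity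
      obtain ⟨k', hk', hlow⟩ := lower dq hqd hA0 (by linarith) hQi1 hkap
      have hx : 0 < c * Real.exp (-(2 / k')) := by positivity
      have hxc : c * Real.exp (-(2 / k')) ≤ c := by
        have : Real.exp (-(2 / k')) ≤ 1 := by
          rw [Real.exp_le_one_iff]
          have : 0 < 2 / k' := by positivity
          linarith
        nlinarith
      have hfin := hlow g _ c hx hxc (by
        intro t ht
        have ht0 : 0 < t := hx.trans ht.1
        have htd := hsub t ht0 (by linarith [ht.2])
        refine ⟨htd, le_trans ?_ (hg2 t ht0 ht.2)⟩
        have ht1 : t ≤ 1 := by linarith [ht.2]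
        have h1 := (close_mul (db t htd)).2
        have h2 := (close_mul (dv t htd)).2
        simp only [stp, ht1, if_true] at h1 h2 ⊢
        have hl0 : Real.log t ≤ 0 := Real.log_nonpos ht0.le ht1
        have h3 : Real.exp (-(2 * A)) * t ^ (-(1 / q0)) ≤ t ^ (b t + v t) := by
          rw [Real.rpow_def_of_pos ht0, Real.rpow_def_of_pos ht0, ← Real.exp_add, Real.exp_le_exp,
            hq0]
          nlinarith
        have h4 := mul_le_mul_of_nonneg_right h3
          (by positivity : 0 ≤ (c * mu) / (2 * C.toReal * 1))
        calc _ = Real.exp (-(2 * A)) * t ^ (-(1 / q0)) * ((c * mu) / (2 * C.toReal * 1)) := by ring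
          _ ≤ _ := h4
          _ = _ := by ring) hg1
      have : Real.log (c / (c * Real.exp (-(2 / k')))) = 2 / k' := by
        have : c / (c * Real.exp (-(2 / k'))) = Real.exp (2 / k') := by
          rw [Real.exp_neg]; field_simp
        rw [this, Real.log_exp]
      rw [this] at hfin
      have : k' * (2 / k') = 2 := by field_simp
      linarith
    · intro hl
      by_contra hcon
      push Not at hcon
      have ePi : Pi = pinf := by rw [hPi, if_pos hl]
      have eQi : Qi = qinf := by rw [hQi, if_pos hl]
      have eBi : Bi = binf := by rw [hBi, if_pos hl]
      have eVi : Vi = vinf := by rw [hVi, if_pos hl]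
      rw [ePi] at hPi1
      have hsub : ∀ s, 0 < s → s ∈ dom ℓ := fun s hs => ⟨hs, by simp [hl]⟩
      set W := |binf + 1| * Real.log 2 with hW
      have hkap : 0 < Real.exp (-(4 * A + W)) / (2 * C.toReal) := by positivity
      obtain ⟨k', hk', hlow⟩ := lower dq hqd hA0 (by linarith) hQi1 hkap
      set LN := 2 / k' with hLN
      have hLN0 : 0 < LN := by positivity
      set N := Real.exp LN with hN
      have hN0 : 0 < N := Real.exp_pos _
      have hN1 : 1 < N := Real.one_lt_exp_iff.2 hLN0
      have hlogN : Real.log N = LN := Real.log_exp _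
      obtain ⟨g, hg1, hg2⟩ := nec (N := N) (lam := Real.exp (A + LN / pinf))
        (mu := Real.exp (-(A + W) - LN * (binf + 1))) hC0 hC H hb.measurable hMB' hp1 hq1
        hN0 (fun s hs => hsub s (hN0.trans_le hs.1)) (Real.exp_pos _)
        (by
          intro s hs
          have hs1 : 1 < s := hN1.trans_le hs.1
          have hs0 : 0 < s := by linarith
          have hps := hp1 s (hsub s hs0)
          have h1 := dp s (hsub s hs0)
          simp only [stp, not_le.2 hs1, if_false, ePi] at h1
          have l1 : LN ≤ Real.log s := by
            rw [← hlogN]; exact Real.log_le_log hN0 hs.1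
          rw [abs_of_pos (by linarith : 0 < Real.log s)] at h1
          have h2 : |p s - pinf| * |LN| ≤ A := by
            rw [abs_of_pos hLN0]
            exact (mul_le_mul_of_nonneg_left l1 (abs_nonneg _)).trans h1
          have h3 := (close_mul h2).2
          have e : 1 / N = Real.exp (-LN) := by rw [hN, Real.exp_neg, one_div]
          rw [e, one_div, ← Real.exp_neg, ← Real.exp_mul, Real.exp_le_exp]
          have hpi0 : 0 < pinf := by linarith [hPi1.1]
          have h4 : (LN * pinf) / pinf ≤ (LN * p s + A) / pinf := by gcongr
          have h5 : (LN * pinf) / pinf = LN := by field_simp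
          have h6 : (LN * p s + A) / pinf = LN / pinf * p s + A / pinf := by ring
          have h7 : A / pinf ≤ A := div_le_self hA0 hPi1.1
          nlinarith)
        (by
          intro s hs
          have hs1 : 1 < s := hN1.trans_le hs.1
          have hs0 : 0 < s := by linarith
          have h1 := (close_mul (db s (hsub s hs0))).1
          simp only [stp, not_le.2 hs1, if_false, eBi] at h1
          rw [← Real.rpow_neg hs0.le, Real.rpow_def_of_pos hs0, Real.exp_le_exp]
          have l1 : LN ≤ Real.log s := by
            rw [← hlogN]; exact Real.log_le_log hN0 hs.1
          have l2 : Real.log s ≤ Real.log 2 + LN := by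
            rw [← hlogN, ← Real.log_mul two_ne_zero hN0.ne']; exact Real.log_le_log hs0 hs.2
          have h2 : (Real.log s - LN) * (binf + 1) ≤ W := by
            calc (Real.log s - LN) * (binf + 1) ≤ (Real.log s - LN) * |binf + 1| :=
                  mul_le_mul_of_nonneg_left (le_abs_self _) (by linarith)
              _ ≤ Real.log 2 * |binf + 1| :=
                  mul_le_mul_of_nonneg_right (by linarith) (abs_nonneg _)
              _ = W := by rw [hW]; ring
          nlinarith)
      have hfin := hlow g 1 N one_pos hN1.le (by
        intro t ht
        have ht1 : 1 < t := ht.1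
        have ht0 : 0 < t := by linarith
        refine ⟨hsub t ht0, le_trans ?_ (hg2 t ht0 ht.2)⟩
        have h1 := (close_mul (db t (hsub t ht0))).2
        have h2 := (close_mul (dv t (hsub t ht0))).2
        simp only [stp, not_le.2 ht1, if_false, eBi, eVi, eQi] at h1 h2 ⊢
        have l0 : Real.log t ≤ LN := by
          rw [← hlogN]; exact Real.log_le_log ht0 ht.2.le
        have l1 : 0 < Real.log t := Real.log_pos ht1
        rw [Real.rpow_def_of_pos ht0, Real.rpow_def_of_pos ht0, hqinf hl, hN]
        have e1 : Real.exp (-(4 * A + W)) / (2 * C.toReal) *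
            Real.exp (Real.log t * -(1 / pinf - vinf)) =
            Real.exp (-(4 * A + W) + Real.log t * -(1 / pinf - vinf)) / (2 * C.toReal) := by
          rw [Real.exp_add]; ring
        have e2 : Real.exp (Real.log t * (b t + v t)) *
            (Real.exp LN * Real.exp (-(A + W) - LN * (binf + 1))) /
              (2 * C.toReal * Real.exp (A + LN / pinf)) =
            Real.exp (Real.log t * (b t + v t) + (LN + (-(A + W) - LN * (binf + 1))) -
              (A + LN / pinf)) / (2 * C.toReal) := by
          have gen : ∀ x y z w c : ℝ, Real.exp x * (Real.exp y * Real.exp z) / (c * Real.exp w) =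
              Real.exp (x + (y + z) - w) / c := by
            intro x y z w c
            rw [Real.exp_sub, Real.exp_add, Real.exp_add, div_div, mul_comm c]
          exact gen _ _ _ _ _
        rw [e1, e2]
        refine div_le_div_of_nonneg_right (Real.exp_le_exp.2 ?_) (by positivity)
        have h3 : 0 ≤ (LN - Real.log t) * (-(1 / pinf) - binf) :=
          mul_nonneg (by linarith) (by linarith)
        have e3 : LN / pinf = LN * (1 / pinf) := by ring
        rw [e3]
        nlinarith) hg1
      rw [div_one, hlogN, hLN] at hfin
      have : k' * (2 / k') = 2 := by field_simp
      linarith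
  · -- sufficiency
    rintro ⟨hb0, hbi⟩
    have hbi' : -(1 / Pi) < Bi := by
      rw [hPi, hBi]; split_ifs with hl
      · exact hbi hl
      · exact hb0
    have hle : ∀ {P Q V : ℝ}, 1 ≤ P → 1 ≤ Q → 0 ≤ V → 1 / Q = 1 / P - V → P ≤ Q := by
      intro P Q V hP hQ hV h
      have : 1 / Q ≤ 1 / P := by linarith
      exact (one_div_le_one_div (by linarith) (by linarith)).1 this
    obtain ⟨K, hK1, hK⟩ := core (a := min (b0 + 1 / p0) (Bi + 1 / Pi)) (P0 := p0) (b0 := b0)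
      hpP.measurable hA0 (lt_min (by linarith) (by linarith)) dp dq db dv hpd hqd
      ⟨by linarith, hp0'.trans (le_max_left _ _)⟩ ⟨hPi1.1, hPi1.2.trans (le_max_left _ _)⟩
      (hle (by linarith) (by linarith) hv0.1 hq0) (hle hPi1.1 hQi1 hVi0 hei) hq0 hei
      (min_le_left _ _) (min_le_right _ _)
    have hK0 : 0 < K := by linarith
    refine ⟨ENNReal.ofReal K, ENNReal.ofReal_pos.2 hK0, ENNReal.ofReal_lt_top, ?_⟩
    intro f mf hf hfin
    have main : ∀ lam : ℝ, 0 < lam → luxNorm ℓ p f < ENNReal.ofReal lam →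
        luxNorm ℓ q (fun t => t ^ (b t + v t) *
            ∫ s in {s : ℝ | t < s ∧ ENNReal.ofReal s < ℓ}, f s / s ^ (b s + 1))
          ≤ ENNReal.ofReal K * ENNReal.ofReal lam := by
      intro lam hlam hlt
      have h1 := lux_mod (fun t ht => (hpd t ht).1) hlam hlt
      have h2 := hK (fun t => f t / lam) (mf.div_const _) (fun t => div_nonneg (hf t) hlam.le)
        (by simpa only [abs_of_nonneg (hf _)] using h1)
      refine sInf_le ⟨?_, ?_⟩
      · rw [← ENNReal.ofReal_mul hK0.le]; exact ENNReal.ofReal_pos.2 (by positivity)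
      change ∫⁻ t in dom ℓ, _ ≤ _
      have h3 : ∀ t ∈ dom ℓ, (ENNReal.ofReal |t ^ (b t + v t) *
            ∫ s in {s : ℝ | t < s ∧ ENNReal.ofReal s < ℓ}, f s / s ^ (b s + 1)| /
            (ENNReal.ofReal K * ENNReal.ofReal lam)) ^ q t ≤
          ENNReal.ofReal K⁻¹ * ENNReal.ofReal |t ^ (b t + v t) *
            ∫ s in {s : ℝ | t < s ∧ ENNReal.ofReal s < ℓ}, (f s / lam) / s ^ (b s + 1)| ^ q t := by
        intro t ht
        have hq1 := (hqd t ht).1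
        have e1 : (fun s => (f s / lam) / s ^ (b s + 1)) =
            fun s => lam⁻¹ * (f s / s ^ (b s + 1)) := by funext s; ring
        rw [e1, integral_const_mul]
        set J := ∫ s in {s : ℝ | t < s ∧ ENNReal.ofReal s < ℓ}, f s / s ^ (b s + 1)
        have e2 : |t ^ (b t + v t) * (lam⁻¹ * J)| = lam⁻¹ * |t ^ (b t + v t) * J| := by
          rw [← abs_of_pos (inv_pos.2 hlam), ← abs_mul, abs_of_pos (inv_pos.2 hlam)]
          congr 1; ring
        rw [e2, ← ENNReal.ofReal_mul hK0.le, ← ENNReal.ofReal_div_of_pos (by positivity)]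
        set X := |t ^ (b t + v t) * J|
        have hX : 0 ≤ X := abs_nonneg _
        have e3 : X / (K * lam) = K⁻¹ * (lam⁻¹ * X) := by field_simp
        rw [e3, ENNReal.ofReal_mul (by positivity),
          ENNReal.mul_rpow_of_nonneg _ _ (by linarith)]
        gcongr
        rw [ENNReal.ofReal_rpow_of_nonneg (by positivity) (by linarith)]
        refine ENNReal.ofReal_le_ofReal ?_
        calc K⁻¹ ^ q t ≤ K⁻¹ ^ (1 : ℝ) :=
              Real.rpow_le_rpow_of_exponent_ge (by positivity) (inv_le_one_of_one_le₀ hK1) hq1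
          _ = K⁻¹ := Real.rpow_one _
      calc _ ≤ _ := setLIntegral_mono' (measurableSet_dom ℓ) h3
        _ = ENNReal.ofReal K⁻¹ * _ := lintegral_const_mul' _ _ ENNReal.ofReal_ne_top
        _ ≤ ENNReal.ofReal K⁻¹ * ENNReal.ofReal K := by gcongr
        _ = 1 := by
            rw [← ENNReal.ofReal_mul (by positivity), inv_mul_cancel₀ hK0.ne', ENNReal.ofReal_one]
    -- pass to the infimum
    rw [mul_comm, ← ENNReal.div_le_iff_le_mul (Or.inl (ENNReal.ofReal_pos.2 hK0).ne')
      (Or.inl ENNReal.ofReal_ne_top)]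
    refine le_of_forall_gt_imp_ge_of_dense fun y hy => ?_
    by_cases hyt : y = ∞
    · rw [hyt]; exact le_top
    have hy0 : 0 < y.toReal := ENNReal.toReal_pos (ne_bot_of_gt hy) hyt
    have := main y.toReal hy0 (by rwa [ENNReal.ofReal_toReal hyt])
    rw [ENNReal.ofReal_toReal hyt, mul_comm] at this
    exact ENNReal.div_le_of_le_mul this

end
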